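/- For every η > 0 there exists ρ > 0 with the following property: for all unital complex C*-algebras A and B (in a fixed universe) and every bounded linear bijection T : A → B with bounded inverse such that T(1) = 1, ‖T‖ ≤ 1 + ρ and ‖T⁻¹‖ ≤ 1 + ρ, one has ‖T(aa') + T(a'a) − T(a)T(a') − T(a')T(a)‖ ≤ η for all a, a' ∈ A with ‖a‖ ≤ 1 and ‖a'‖ ≤ 1. -/

import Mathlib

open Complex Filter Topology Asymptotics

section Involution

variable {A : Type*} [NormedRing A] [StarRing A] [CStarRing A] [NormedAlgebra ℂ A]

theorem star_ofReal_smul (t : ℝ) (x : A) : star ((t : ℂ) • x) = (t : ℂ) • star x := by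
  rw [Complex.coe_smul, Complex.coe_smul]
  exact map_real_smul (starAddEquiv : A ≃+ A) (continuous_star : Continuous (star : A → A)) t x

omit [CStarRing A] in
theorem star_I_smul (x : A) : star (I • x) = star (I • (1 : A)) * star x := by
  have h : star (I • x) = star ((I • (1 : A)) * x) := by simp
  have h' : star (I • x) = star (x * (I • (1 : A))) := by simp
  rw [h', star_mul]

omit [CStarRing A] in
theorem star_I_commute (x : A) : Commute (star (I • (1 : A))) x := by
  have h : star (star x * (I • (1 : A))) = star ((I • (1 : A)) * star x) := by simp
  rwa [star_mul, star_mul, star_star] at h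

omit [CStarRing A] in
theorem star_I_mul_self : star (I • (1 : A)) * star (I • (1 : A)) = -1 := by
  rw [← star_mul]
  simp [smul_smul]

/-- The central projection onto the part of `A` on which the involution is conjugate-linear. -/
noncomputable def conjProj (A : Type*) [NormedRing A] [StarRing A] [NormedAlgebra ℂ A] : A :=
  (2⁻¹ : ℂ) • (1 + I • star (I • (1 : A)))

omit [CStarRing A] in
theorem conjProj_commute (x : A) : Commute (conjProj A) x :=
  ((Commute.one_left x).add_left ((star_I_commute x).smul_left I)).smul_left _

omit [CStarRing A] in
theorem conjProj_mul_self : conjProj A * conjProj A = conjProj A := by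
  have h := star_I_mul_self (A := A)
  simp only [conjProj, smul_mul_smul_comm, add_mul, mul_add, one_mul, mul_one, h]
  simp only [I_mul_I]
  module

theorem star_conjProj : star (conjProj A) = conjProj A := by
  have h : star (I • star (I • (1 : A))) = I • star (I • (1 : A)) := by
    rw [star_I_smul, star_star]
    simp
  have h2 := star_ofReal_smul (2⁻¹ : ℝ) (1 + I • star (I • (1 : A)))
  push_cast at h2
  rw [conjProj, h2, star_add, star_one, h]

omit [CStarRing A] in
theorem star_I_mul_conjProj : star (I • (1 : A)) * conjProj A = -(I • conjProj A) := by
  have h := star_I_mul_self (A := A)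
  simp only [conjProj, mul_smul_comm, mul_add, mul_one, h]
  match_scalars
  · linear_combination (1 / 2 : ℂ) * I_sq
  · ring

omit [CStarRing A] in
theorem star_I_mul_one_sub_conjProj :
    star (I • (1 : A)) * (1 - conjProj A) = I • (1 - conjProj A) := by
  have h := star_I_mul_self (A := A)
  simp only [conjProj, mul_smul_comm, mul_add, mul_one, mul_sub, h]
  match_scalars
  · linear_combination (1 / 2 : ℂ) * I_sq
  · ring

theorem star_smul_of_I {x : A} {s : ℂ} (hs : star (I • x) = s • star x) (z : ℂ) :
    star (z • x) = ((z.re : ℂ) + z.im * s) • star x := by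
  conv_lhs => rw [← re_add_im z, add_smul, mul_smul, star_add, star_ofReal_smul,
    star_ofReal_smul, hs]
  module

/-- The ideal of `A` on which the involution is conjugate-linear. -/
noncomputable def conjIdeal (A : Type*) [NormedRing A] [StarRing A] [CStarRing A]
    [NormedAlgebra ℂ A] : NonUnitalStarSubalgebra ℂ A where
  carrier := {x | conjProj A * x = x}
  add_mem' {x y} hx hy := by
    simp only [Set.mem_ofPred_eq] at hx hy ⊢
    rw [mul_add, hx, hy]
  zero_mem' := mul_zero _
  mul_mem' {x y} hx hy := by
    simp only [Set.mem_ofPred_eq] at hx hy ⊢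
    rw [← mul_assoc, hx]
  smul_mem' z x hx := by
    simp only [Set.mem_ofPred_eq] at hx ⊢
    rw [mul_smul_comm, hx]
  star_mem' {x} hx := by
    simp only [Set.mem_ofPred_eq] at hx ⊢
    nth_rewrite 2 [← hx]
    rw [star_mul, star_conjProj, (conjProj_commute _).eq]

theorem mem_conjIdeal {x : A} : x ∈ conjIdeal A ↔ conjProj A * x = x := Iff.rfl

theorem conjProj_mul_mem_conjIdeal (x : A) : conjProj A * x ∈ conjIdeal A := by
  rw [mem_conjIdeal, ← mul_assoc, conjProj_mul_self]

theorem isClosed_conjIdeal : IsClosed (conjIdeal A : Set A) :=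
  isClosed_eq (continuous_const.mul continuous_id) continuous_id

theorem star_smul_of_mem_conjIdeal {x : A} (hx : x ∈ conjIdeal A) (z : ℂ) :
    star (z • x) = star z • star x := by
  have h : star (I • x) = (-I) • star x := by
    rw [star_I_smul, ← mem_conjIdeal.1 (star_mem hx), ← mul_assoc, star_I_mul_conjProj]
    simp
  rw [star_smul_of_I h]
  congr 1
  apply Complex.ext <;> simp

noncomputable instance [CompleteSpace A] : NonUnitalCStarAlgebra (conjIdeal A) where
  toCompleteSpace := isClosed_conjIdeal.completeSpace_coe
  norm_mul_self_le x := (CStarRing.norm_star_mul_self (x := (x : A))).symm.le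
  star_smul z x := Subtype.ext (star_smul_of_mem_conjIdeal x.2 z)

/-- On the complementary ideal the involution is the identity. -/
theorem star_one_sub_conjProj_mul [CompleteSpace A] (x : A) :
    star ((1 - conjProj A) * x) = (1 - conjProj A) * x := by
  have hf : ∀ x : A, Commute (1 - conjProj A) x := fun x =>
    (Commute.one_left x).sub_left (conjProj_commute x)
  have hstar : ∀ x : A, star ((1 - conjProj A) * x) = (1 - conjProj A) * star x := fun x => by
    rw [star_mul, star_sub, star_one, star_conjProj, (hf _).eq]
  set y : A := (1 - conjProj A) * (x - star x) with hy
  have hsy : star y = -y := by rw [hy, hstar, star_sub, star_star, ← mul_neg, neg_sub]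
  have hI : star (I • y) = I • star y := by
    rw [star_I_smul, hy, hstar, ← mul_assoc, star_I_mul_one_sub_conjProj]
    simp
  have hz : ∀ z : ℂ, star (z • y) = -(z • y) := fun z => by
    rw [star_smul_of_I hI, re_add_im, hsy, smul_neg]
  let _ : NormedAlgebra ℚ A := NormedAlgebra.restrictScalars ℚ ℂ A
  have hbd : ∀ z : ℂ, ‖NormedSpace.exp (z • y)‖ ≤ 1 := fun z => by
    have h1 : star (NormedSpace.exp (z • y)) * NormedSpace.exp (z • y) = 1 := by
      rw [NormedSpace.star_exp, hz, ← NormedSpace.exp_add_of_commute (Commute.refl _).neg_left]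
      simp
    have h2 := CStarRing.norm_star_mul_self (x := NormedSpace.exp (z • y))
    rw [h1] at h2
    have h3 : ‖(1 : A)‖ ≤ 1 := by
      rcases subsingleton_or_nontrivial A with h | h
      · simp [Subsingleton.elim (1 : A) 0]
      · simp
    nlinarith [norm_nonneg (NormedSpace.exp (z • y))]
  have hder : ∀ z : ℂ, HasDerivAt (fun u : ℂ => NormedSpace.exp (u • y))
      (NormedSpace.exp (z • y) * y) z := fun z => hasDerivAt_exp_smul_const y z
  have hconst := Differentiable.apply_eq_apply_of_bounded
    (fun z => (hder z).differentiableAt)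
    (isBounded_iff_forall_norm_le.2 ⟨1, by rintro _ ⟨z, rfl⟩; exact hbd z⟩)
  have hy0 : y = 0 := by
    have h1 := hder 0
    have h2 : (fun u : ℂ => NormedSpace.exp (u • y)) = fun _ => 1 := by
      funext u
      rw [hconst u 0]
      simp
    rw [h2] at h1
    simpa using h1.unique (hasDerivAt_const (0 : ℂ) (1 : A))
  rw [hy, mul_sub, sub_eq_zero] at hy0
  rw [hstar, hy0]

end Involution

theorem norm_mobius_le_of_nonUnital {D : Type*} [NonUnitalCStarAlgebra D] {e a c : D}
    (he : IsSelfAdjoint e) (hee : e * e = e) (hea : e * a = a) (hae : a * e = a) (ha : ‖a‖ ≤ 1)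
    {t : ℝ} (ht : |t| < 1) (hc : (e - (t : ℂ) • a) * c = e) : ‖(a - (t : ℂ) • e) * c‖ ≤ 1 := by
  let _ := CStarAlgebra.spectralOrder D
  have := CStarAlgebra.spectralOrderedRing D
  have hse : star e = e := he
  have hsea : star a * e = star a := by
    have := congrArg star hea
    rwa [star_mul, hse] at this
  have heas : e * star a = star a := by
    have := congrArg star hae
    rwa [star_mul, hse] at this
  have he0 : 0 ≤ e := by
    have := star_mul_self_nonneg e
    rwa [hse, hee] at this
  have hp : star a * a ≤ e := by
    have h1 := CStarAlgebra.star_left_conjugate_le_norm_smul (a := e) (b := star a * a)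
      (.star_mul_self a)
    rw [hse, hee, ← mul_assoc, heas, mul_assoc, hae, CStarRing.norm_star_mul_self] at h1
    refine h1.trans ?_
    calc (‖a‖ * ‖a‖) • e ≤ (1 : ℝ) • e :=
          smul_le_smul_of_nonneg_right (by nlinarith [norm_nonneg a]) he0
      _ = e := one_smul _ _
  have hkey : star (e - (t : ℂ) • a) * (e - (t : ℂ) • a)
      - star (a - (t : ℂ) • e) * (a - (t : ℂ) • e) = (1 - t ^ 2) • (e - star a * a) := by
    simp only [star_sub, star_smul, hse, sub_mul, mul_sub, smul_mul_assoc, mul_smul_comm, hee,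
      hea, hsea, RCLike.star_def, conj_trivial, Complex.coe_smul]
    module
  have hm : star ((a - (t : ℂ) • e) * c) * ((a - (t : ℂ) • e) * c) ≤ e := by
    have h0 : 0 ≤ star c * ((1 - t ^ 2) • (e - star a * a)) * c :=
      star_left_conjugate_nonneg
        (smul_nonneg (by nlinarith [abs_lt.1 ht]) (sub_nonneg.2 hp)) c
    rw [← hkey] at h0
    have h1 : ∀ x y : D, star c * (star y * y - star x * x) * c
        = star (y * c) * (y * c) - star (x * c) * (x * c) := fun x y => by
      simp only [star_mul, mul_sub, sub_mul, mul_assoc]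
    rw [h1, hc, hse, hee] at h0
    exact sub_nonneg.1 h0
  have hn := CStarAlgebra.norm_le_norm_of_nonneg_of_le (star_mul_self_nonneg _) hm
  have hne : ‖e‖ ≤ 1 := by
    have := CStarRing.norm_star_mul_self (x := e)
    rw [hse, hee] at this
    nlinarith [norm_nonneg e]
  rw [CStarRing.norm_star_mul_self] at hn
  nlinarith [norm_nonneg ((a - (t : ℂ) • e) * c)]

section Mobius

variable {A : Type*} [NormedRing A] [StarRing A] [CStarRing A] [NormedAlgebra ℂ A]

theorem norm_conjProj_mul_le (x : A) : ‖conjProj A * x‖ ≤ ‖x‖ := by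
  have h : ‖conjProj A‖ ≤ 1 := by
    have := CStarRing.norm_star_mul_self (x := conjProj A)
    rw [star_conjProj, conjProj_mul_self] at this
    nlinarith [norm_nonneg (conjProj A)]
  exact (norm_mul_le _ _).trans (mul_le_of_le_one_left (norm_nonneg _) h)

omit [CStarRing A] in
theorem one_sub_conjProj_commute (x : A) : Commute (1 - conjProj A) x :=
  (Commute.one_left x).sub_left (conjProj_commute x)

omit [CStarRing A] in
theorem one_sub_conjProj_mul_self : (1 - conjProj A) * (1 - conjProj A) = 1 - conjProj A := by
  rw [mul_sub, sub_mul, sub_mul, conjProj_mul_self]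
  simp

omit [CStarRing A] in
theorem conjProj_mul_pow (x : A) {n : ℕ} (hn : n ≠ 0) :
    (conjProj A * x) ^ n = conjProj A * x ^ n := by
  have h : IsIdempotentElem (conjProj A) := conjProj_mul_self
  rw [(conjProj_commute x).mul_pow, h.pow_eq hn]

omit [CStarRing A] in
theorem one_sub_conjProj_mul_pow (x : A) {n : ℕ} (hn : n ≠ 0) :
    ((1 - conjProj A) * x) ^ n = (1 - conjProj A) * x ^ n := by
  have h : IsIdempotentElem (1 - conjProj A) := one_sub_conjProj_mul_self
  rw [(one_sub_conjProj_commute x).mul_pow, h.pow_eq hn]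

theorem spectralRadius_eq_nnnorm_of_isSelfAdjoint [CompleteSpace A] {x : A}
    (hx : IsSelfAdjoint x) : spectralRadius ℂ x = ‖x‖₊ := by
  have hconst : Tendsto (fun _ : ℕ => (‖x‖₊ : ENNReal)) atTop (𝓝 (‖x‖₊ : ENNReal)) :=
    tendsto_const_nhds
  refine tendsto_nhds_unique ?_ hconst
  convert! (spectrum.pow_nnnorm_pow_one_div_tendsto_nhds_spectralRadius x).comp
    (tendsto_pow_atTop_atTop_of_one_lt one_lt_two) using 1
  refine funext fun n => ?_
  rw [Function.comp_apply, hx.nnnorm_pow_two_pow, ENNReal.coe_pow, ← ENNReal.rpow_natCast,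
    ← ENNReal.rpow_mul]
  simp

/-- The norm of `A` is the maximum over the two complementary ideals. -/
theorem norm_le_one_of_conjProj {x : A} (h₁ : ‖conjProj A * x‖ ≤ 1)
    (h₂ : ‖(1 - conjProj A) * x‖ ≤ 1) : ‖x‖ ≤ 1 := by
  have hmul : ∀ p : A, star p = p → p * p = p → (∀ y, Commute p y) → ‖p * x‖ ≤ 1 →
      ‖p * (star x * x)‖ ≤ 1 := fun p hp hpp hc hx => by
    have : p * (star x * x) = star (p * x) * (p * x) := by
      rw [star_mul, hp, (hc _).symm.eq]
      rw [← hpp, mul_assoc p p, ← mul_assoc p (star x), (hc (star x)).eq]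
      simp only [mul_assoc, hpp]
    rw [this, CStarRing.norm_star_mul_self]
    nlinarith [norm_nonneg (p * x)]
  have h₁' := hmul _ star_conjProj conjProj_mul_self conjProj_commute h₁
  have h₂' := hmul _ (by rw [star_sub, star_one, star_conjProj]) one_sub_conjProj_mul_self
    one_sub_conjProj_commute h₂
  set h := star x * x with hh
  have hpow : ∀ n : ℕ, ‖h‖ ^ 2 ^ n ≤ 2 := fun n => by
    have hs := congrArg NNReal.toReal ((IsSelfAdjoint.star_mul_self x).nnnorm_pow_two_pow n)
    push_cast at hs
    rw [← hs, ← hh]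
    have : h ^ 2 ^ n = (conjProj A * h) ^ 2 ^ n + ((1 - conjProj A) * h) ^ 2 ^ n := by
      rw [conjProj_mul_pow _ (by positivity), one_sub_conjProj_mul_pow _ (by positivity),
        ← add_mul]
      simp
    rw [this]
    calc _ ≤ ‖(conjProj A * h) ^ 2 ^ n‖ + ‖((1 - conjProj A) * h) ^ 2 ^ n‖ := norm_add_le _ _
      _ ≤ ‖conjProj A * h‖ ^ 2 ^ n + ‖(1 - conjProj A) * h‖ ^ 2 ^ n :=
        add_le_add (norm_pow_le' _ (by positivity)) (norm_pow_le' _ (by positivity))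
      _ ≤ 1 + 1 := add_le_add (pow_le_one₀ (norm_nonneg _) h₁') (pow_le_one₀ (norm_nonneg _) h₂')
      _ = 2 := by norm_num
  have hle : ‖h‖ ≤ 1 := by
    by_contra! hlt
    obtain ⟨n, hn⟩ := ((tendsto_pow_atTop_atTop_of_one_lt hlt).comp
      (tendsto_pow_atTop_atTop_of_one_lt one_lt_two)).eventually_gt_atTop 2 |>.exists
    exact absurd hn (not_lt.2 (hpow n))
  rw [hh, CStarRing.norm_star_mul_self] at hle
  nlinarith [norm_nonneg x]

omit [StarRing A] [CStarRing A] in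
theorem isUnit_smul_one_sub [CompleteSpace A] {z w : ℂ} {a : A} (ha : ‖a‖ ≤ 1)
    (h : ‖w‖ < ‖z‖) : IsUnit (z • (1 : A) - w • a) := by
  have hz : z ≠ 0 := norm_pos_iff.1 ((norm_nonneg w).trans_lt h)
  have h1 : ‖(z⁻¹ * w) • a‖ < 1 := by
    rw [norm_smul, norm_mul, norm_inv]
    calc ‖z‖⁻¹ * ‖w‖ * ‖a‖ ≤ ‖z‖⁻¹ * ‖w‖ * 1 := by gcongr
      _ < 1 := by
        rw [mul_one, inv_mul_lt_one₀ ((norm_nonneg w).trans_lt h)]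
        exact h
  have h2 := (isUnit_one_sub_of_norm_lt_one h1).smul (Units.mk0 z hz)
  rwa [Units.smul_mk0, smul_sub, smul_smul, mul_inv_cancel_left₀ hz] at h2

/-- Von Neumann's inequality for disc automorphisms with real parameter. -/
theorem norm_mobius_le [CompleteSpace A] {a : A} (ha : ‖a‖ ≤ 1) {t : ℝ} (ht : |t| < 1) :
    ‖(a - (t : ℂ) • 1) * Ring.inverse (1 - (t : ℂ) • a)‖ ≤ 1 := by
  have hu : IsUnit (1 - (t : ℂ) • a) := by
    have := isUnit_smul_one_sub (z := 1) (w := t) ha (by simpa using ht)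
    rwa [one_smul] at this
  set c := Ring.inverse (1 - (t : ℂ) • a) with hcdef
  have hc : (1 - (t : ℂ) • a) * c = 1 := Ring.mul_inverse_cancel _ hu
  have hcu : IsUnit c := hu.ringInverse
  refine norm_le_one_of_conjProj ?_ ?_
  · have hee := conjProj_mul_self (A := A)
    let e' : conjIdeal A := ⟨conjProj A, hee⟩
    let a' : conjIdeal A := ⟨conjProj A * a, conjProj_mul_mem_conjIdeal a⟩
    let c' : conjIdeal A := ⟨conjProj A * c, conjProj_mul_mem_conjIdeal c⟩
    have hmm : ∀ x y : A, (conjProj A * x) * (conjProj A * y) = conjProj A * (x * y) :=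
      fun x y => by
        rw [mul_assoc, ← mul_assoc x, ← (conjProj_commute x).eq, mul_assoc, ← mul_assoc, hee]
    have key := norm_mobius_le_of_nonUnital (D := conjIdeal A) (e := e') (a := a') (c := c')
      (Subtype.ext star_conjProj) (Subtype.ext hee)
      (Subtype.ext (by simp only [e', a', NonUnitalStarSubalgebra.coe_mul]; rw [← mul_assoc, hee]))
      (Subtype.ext (by
        change conjProj A * a * conjProj A = conjProj A * a
        rw [← (conjProj_commute _).eq, ← mul_assoc, hee]))
      ((norm_conjProj_mul_le a).trans ha) ht
      (Subtype.ext (by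
        change (conjProj A - (t : ℂ) • (conjProj A * a)) * (conjProj A * c) = conjProj A
        have : conjProj A - (t : ℂ) • (conjProj A * a) = conjProj A * (1 - (t : ℂ) • a) := by
          rw [mul_sub, mul_one, mul_smul_comm]
        rw [this, hmm, hc, mul_one]))
    change ‖(conjProj A * a - (t : ℂ) • conjProj A) * (conjProj A * c)‖ ≤ 1 at key
    have : conjProj A * a - (t : ℂ) • conjProj A = conjProj A * (a - (t : ℂ) • 1) := by
      rw [mul_sub, mul_smul_comm, mul_one]
    rwa [this, hmm] at key
  · set m := (a - (t : ℂ) • 1) * c with hm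
    have hsp : spectralRadius ℂ ((1 - conjProj A) * m) ≤ 1 := by
      refine iSup₂_le fun μ hμ => ?_
      by_contra! hlt
      have hlt' : 1 < ‖μ‖ := by exact_mod_cast hlt
      refine hμ ?_
      have hmu : IsUnit (μ • (1 : A) - m) := by
        have h1 : μ • (1 : A) - m = ((μ + t) • (1 : A) - (1 + μ * t) • a) * c := by
          have h2 : μ • (1 : A) = μ • ((1 - (t : ℂ) • a) * c) := by rw [hc]
          rw [h2, hm, ← smul_mul_assoc, ← sub_mul]
          congr 1
          module
        rw [h1]
        refine (isUnit_smul_one_sub ha ?_).mul hcu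
        have h3 : ‖μ + t‖ ^ 2 - ‖1 + μ * t‖ ^ 2 = (‖μ‖ ^ 2 - 1) * (1 - t ^ 2) := by
          simp only [← normSq_eq_norm_sq, normSq_apply, add_re, add_im, mul_re, mul_im, ofReal_re,
            ofReal_im, one_re, one_im]
          ring
        have h4 : 0 < (‖μ‖ ^ 2 - 1) * (1 - t ^ 2) :=
          mul_pos (by nlinarith) (by nlinarith [abs_lt.1 ht])
        exact lt_of_pow_lt_pow_left₀ 2 (norm_nonneg _) (by linarith)
      obtain ⟨v, hv⟩ := hmu
      have hμ0 : μ ≠ 0 := norm_pos_iff.1 (by linarith)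
      have hcomm := one_sub_conjProj_commute (A := A)
      have hff := one_sub_conjProj_mul_self (A := A)
      set f := 1 - conjProj A with hf
      have hfg : f * (1 - f) = 0 := by rw [mul_sub, hff, mul_one, sub_self]
      have hgf : (1 - f) * f = 0 := by rw [sub_mul, hff, one_mul, sub_self]
      have hgg : (1 - f) * (1 - f) = 1 - f := by rw [mul_sub, hgf, mul_one, sub_zero]
      have hdec : algebraMap ℂ A μ - f * m = f * v + μ • (1 - f) := by
        rw [hv, Algebra.algebraMap_eq_smul_one, mul_sub, mul_smul_comm, mul_one]
        module
      change IsUnit (algebraMap ℂ A μ - f * m)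
      rw [hdec]
      refine isUnit_iff_exists.2 ⟨f * ↑v⁻¹ + μ⁻¹ • (1 - f), ?_, ?_⟩
      all_goals
        rw [add_mul, mul_add, mul_add]
        simp only [mul_smul_comm, smul_mul_assoc, hgg]
      · have e1 : f * v * (f * ↑v⁻¹) = f := by
          rw [(hcomm v).eq, mul_assoc, ← mul_assoc f f, hff, (hcomm _).eq, ← mul_assoc,
            Units.mul_inv, one_mul]
        have e2 : f * v * (1 - f) = 0 := by rw [(hcomm v).eq, mul_assoc, hfg, mul_zero]
        have e3 : (1 - f) * (f * ↑v⁻¹) = 0 := by rw [← mul_assoc, hgf, zero_mul]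
        rw [e1, e2, e3]
        simp [smul_smul, hμ0]
      · have e1 : f * ↑v⁻¹ * (f * v) = f := by
          rw [(hcomm _).eq, mul_assoc, ← mul_assoc f f, hff, (hcomm _).eq, ← mul_assoc,
            Units.inv_mul, one_mul]
        have e2 : f * ↑v⁻¹ * (1 - f) = 0 := by rw [(hcomm _).eq, mul_assoc, hfg, mul_zero]
        have e3 : (1 - f) * (f * v) = 0 := by rw [← mul_assoc, hgf, zero_mul]
        rw [e1, e2, e3]
        simp [smul_smul, hμ0]
    rw [spectralRadius_eq_nnnorm_of_isSelfAdjoint (star_one_sub_conjProj_mul m)] at hsp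
    exact_mod_cast hsp

end Mobius

section Cartan

variable {E : Type*} [NormedAddCommGroup E] [NormedSpace ℂ E]

theorem ContinuousLinearMap.isBigO_apply₂ {α : Type*} {l : Filter α} (L : E →L[ℂ] E →L[ℂ] E)
    {f g : α → E} {F G : α → ℝ} (hf : f =O[l] F) (hg : g =O[l] G) :
    (fun a => L (f a) (g a)) =O[l] fun a => F a * G a := by
  refine IsBigO.trans ?_ (hf.norm_left.mul hg.norm_left)
  refine IsBigO.of_bound ‖L‖ (Eventually.of_forall fun a => ?_)
  rw [norm_mul, norm_norm, norm_norm, ← mul_assoc]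
  exact L.le_opNorm₂ _ _

omit [NormedSpace ℂ E] in
theorem isBigO_norm_pow_of_le {m n : ℕ} (h : m ≤ n) :
    (fun x : E => ‖x‖ ^ n) =O[𝓝 0] fun x : E => ‖x‖ ^ m := by
  refine IsBigO.of_bound 1 ?_
  filter_upwards [Metric.closedBall_mem_nhds (0 : E) one_pos] with x hx
  rw [mem_closedBall_zero_iff] at hx
  simpa using pow_le_pow_of_le_one (norm_nonneg x) hx h

/-- The second-order expansion of the iterates of a map with linear part `c • id`. -/
theorem exists_iterate_expansion {G : E → E} {L : E →L[ℂ] E →L[ℂ] E} {c : ℝ} (hc0 : 0 ≤ c)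
    (hc1 : c ≤ 1)
    (hG : (fun x => G x - ((c : ℂ) • x + L x x)) =O[𝓝 0] fun x => ‖x‖ ^ 3) (n : ℕ) :
    ∃ s : ℝ, n * c ^ (2 * n) ≤ s ∧
      (fun x => G^[n] x - (((c ^ n : ℝ) : ℂ) • x + (s : ℂ) • L x x)) =O[𝓝 0]
        fun x => ‖x‖ ^ 3 := by
  induction n with
  | zero => exact ⟨0, by simp, by simpa using isBigO_zero _ _⟩
  | succ n ih =>
    obtain ⟨s, hs, hO⟩ := ih
    refine ⟨c * s + c ^ (2 * n), ?_, ?_⟩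
    · have h1 : (n : ℝ) * c ^ (2 * n) * c ≤ c * s := by nlinarith
      have h2 : (n : ℝ) * c ^ (2 * n) * c ^ 2 ≤ n * c ^ (2 * n) * c :=
        mul_le_mul_of_nonneg_left (by nlinarith) (by positivity)
      have h3 : c ^ (2 * n) * c ^ 2 ≤ c ^ (2 * n) :=
        mul_le_of_le_one_right (by positivity) (by nlinarith)
      have h4 : c ^ (2 * (n + 1)) = c ^ (2 * n) * c ^ 2 := by ring
      rw [h4]
      push_cast
      linarith
    · have hid : (fun x : E => x) =O[𝓝 0] fun x => ‖x‖ := (isBigO_refl _ _).norm_right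
      have hLxx : (fun x => L x x) =O[𝓝 0] fun x => ‖x‖ ^ 2 := by
        simpa only [sq] using L.isBigO_apply₂ hid hid
      have hd : (fun x => G^[n] x - ((c ^ n : ℝ) : ℂ) • x) =O[𝓝 0] fun x => ‖x‖ ^ 2 := by
        have := (hO.trans (isBigO_norm_pow_of_le (show 2 ≤ 3 by norm_num))).add
          (hLxx.const_smul_left (s : ℂ))
        exact this.congr_left fun x => by simp only [Pi.smul_apply]; abel
      have hy : (fun x => G^[n] x) =O[𝓝 0] fun x => ‖x‖ := by
        have h1 : (fun x : E => ‖x‖ ^ 2) =O[𝓝 0] fun x : E => ‖x‖ := by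
          simpa using isBigO_norm_pow_of_le (E := E) (show 1 ≤ 2 by norm_num)
        exact ((hd.trans h1).add (hid.const_smul_left ((c ^ n : ℝ) : ℂ))).congr_left
          fun x => by simp
      have hy0 : Tendsto (fun x => G^[n] x) (𝓝 0) (𝓝 0) :=
        hy.trans_tendsto (by simpa using tendsto_norm_zero (E := E))
      have h1 : (fun x => G (G^[n] x) - ((c : ℂ) • G^[n] x + L (G^[n] x) (G^[n] x)))
          =O[𝓝 0] fun x => ‖x‖ ^ 3 :=
        (hG.comp_tendsto hy0).trans (hy.norm_left.pow 3)
      have h2 := hO.const_smul_left (c : ℂ)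
      have h3 : (fun x => L (G^[n] x - ((c ^ n : ℝ) : ℂ) • x) (G^[n] x)) =O[𝓝 0]
          fun x => ‖x‖ ^ 3 :=
        (L.isBigO_apply₂ hd hy).congr_right fun x => by ring
      have h4 : (fun x => L (((c ^ n : ℝ) : ℂ) • x) (G^[n] x - ((c ^ n : ℝ) : ℂ) • x)) =O[𝓝 0]
          fun x => ‖x‖ ^ 3 :=
        (L.isBigO_apply₂ (hid.const_smul_left _) hd).congr_right fun x => by ring
      refine (((h1.add h2).add h3).add h4).congr_left fun x => ?_
      rw [Function.iterate_succ_apply']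
      simp only [Pi.smul_apply, map_sub, map_smul, sub_apply,
        smul_apply]
      push_cast
      module

/-- A quantitative form of Cartan's uniqueness theorem: the quadratic part of a holomorphic
self-map of the unit ball whose linear part is close to the identity is small. -/
theorem quadratic_part_le [CompleteSpace E] {G : E → E}
    (hmaps : ∀ x, ‖x‖ ≤ 1 → ‖G x‖ ≤ 1) (hd : ∀ x, ‖x‖ ≤ 1 → DifferentiableAt ℂ G x)
    {L : E →L[ℂ] E →L[ℂ] E} {c : ℝ} (hc0 : 0 ≤ c) (hc1 : c ≤ 1)
    (hG : (fun x => G x - ((c : ℂ) • x + L x x)) =O[𝓝 0] fun x => ‖x‖ ^ 3) (n : ℕ) {x : E}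
    (hx : ‖x‖ ≤ 1) : n * c ^ (2 * n) * ‖L x x‖ ≤ 6 := by
  obtain ⟨s, hs, hO⟩ := exists_iterate_expansion hc0 hc1 hG n
  have hmapsn : ∀ m : ℕ, ∀ y, ‖y‖ ≤ 1 → ‖G^[m] y‖ ≤ 1 := fun m => by
    induction m with
    | zero => exact fun y hy => hy
    | succ m ih => exact fun y hy => ih _ (hmaps y hy)
  have hdn : ∀ m : ℕ, ∀ y, ‖y‖ ≤ 1 → DifferentiableAt ℂ (G^[m]) y := fun m => by
    induction m with
    | zero => exact fun y _ => differentiableAt_id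
    | succ m ih => exact fun y hy => (ih _ (hmaps y hy)).comp y (hd y hy)
  have hsmul : ∀ z : ℂ, ‖z‖ ≤ 1 → ‖z • x‖ ≤ 1 := fun z hz => by
    rw [norm_smul]
    exact mul_le_one₀ hz (norm_nonneg _) hx
  set g : ℂ → E := fun z => (z ^ 2)⁻¹ • (G^[n] (z • x) - ((c ^ n : ℝ) : ℂ) • z • x) with hg
  set k : ℂ → E := Function.update g 0 ((s : ℂ) • L x x) with hk
  have hkne : ∀ z ≠ 0, k z = g z := fun z hz => Function.update_of_ne hz _ _
  have hcont : ContinuousAt k 0 := by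
    rw [hk, continuousAt_update_same]
    have hz : Tendsto (fun z : ℂ => z • x) (𝓝[≠] 0) (𝓝 0) := by
      have : ContinuousAt (fun z : ℂ => z • x) 0 := by fun_prop
      simpa using this.tendsto.mono_left nhdsWithin_le_nhds
    have h1 : (fun z : ℂ => G^[n] (z • x)
        - (((c ^ n : ℝ) : ℂ) • z • x + (s : ℂ) • L (z • x) (z • x))) =O[𝓝[≠] 0]
        fun z => ‖z‖ ^ 3 := by
      refine (hO.comp_tendsto hz).trans (IsBigO.of_bound 1 (Eventually.of_forall fun z => ?_))
      simp only [Function.comp_apply, norm_pow, norm_mul, norm_norm, one_mul, norm_smul]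
      exact pow_le_pow_left₀ (mul_nonneg (norm_nonneg z) (norm_nonneg x))
        (mul_le_of_le_one_right (norm_nonneg _) hx) 3
    have h2 : (fun z : ℂ => g z - (s : ℂ) • L x x) =O[𝓝[≠] 0] fun z => ‖z‖ := by
      have h3 : (fun z : ℂ => (z ^ 2)⁻¹) =O[𝓝[≠] 0] fun z => (‖z‖ ^ 2)⁻¹ :=
        IsBigO.of_bound 1 (Eventually.of_forall fun z => by simp)
      refine (h3.smul h1).congr' ?_ ?_
      · filter_upwards [self_mem_nhdsWithin] with z hz0
        have hz0 : z ≠ 0 := hz0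
        simp only [hg, map_smul, smul_apply]
        match_scalars <;> field_simp
      · filter_upwards [self_mem_nhdsWithin] with z hz0
        have hz0 : ‖z‖ ≠ 0 := norm_ne_zero_iff.2 hz0
        simp only [smul_eq_mul]
        field_simp
    have h4 : Tendsto (fun z : ℂ => g z - (s : ℂ) • L x x) (𝓝[≠] 0) (𝓝 0) :=
      h2.trans_tendsto ((by simpa using tendsto_norm_zero (E := ℂ) :
        Tendsto (fun z : ℂ => ‖z‖) (𝓝 0) (𝓝 0)).mono_left nhdsWithin_le_nhds)
    simpa using h4.add_const ((s : ℂ) • L x x)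
  have hdiff : DifferentiableOn ℂ k (Metric.ball 0 1) := by
    rw [← differentiableOn_compl_singleton_and_continuousAt_iff (Metric.ball_mem_nhds _ one_pos)]
    refine ⟨?_, hcont⟩
    refine DifferentiableOn.congr (f := g) (fun z hz => ?_) (fun z hz => hkne z hz.2)
    have hz1 : ‖z‖ ≤ 1 := (mem_ball_zero_iff.1 hz.1).le
    have hz0 : z ≠ 0 := hz.2
    have h1 : DifferentiableAt ℂ (fun z : ℂ => G^[n] (z • x)) z :=
      DifferentiableAt.comp (f := fun z : ℂ => z • x) z (hdn n _ (hsmul z hz1)) (by fun_prop)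
    have h2 : DifferentiableAt ℂ (fun z : ℂ => (z ^ 2)⁻¹) z :=
      (differentiableAt_id.pow 2).inv (pow_ne_zero 2 hz0)
    exact (h2.smul (h1.sub (by fun_prop))).differentiableWithinAt
  have hk0 : ‖k 0‖ ≤ 6 := by
    refine norm_le_of_forall_mem_frontier_norm_le (U := Metric.ball (0 : ℂ) (1 / 2))
      Metric.isBounded_ball ?_ (fun z hz => ?_) (subset_closure (by simp))
    · refine (hdiff.mono ?_).diffContOnCl
      rw [closure_ball _ (by norm_num)]
      exact Metric.closedBall_subset_ball (by norm_num)
    · rw [frontier_ball _ (by norm_num), mem_sphere_zero_iff_norm] at hz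
      have hz0 : z ≠ 0 := norm_pos_iff.1 (by rw [hz]; norm_num)
      rw [hkne z hz0, hg, norm_smul, norm_inv, norm_pow, hz]
      have h1 := hmapsn n _ (hsmul z (by rw [hz]; norm_num))
      have h2 : ‖((c ^ n : ℝ) : ℂ) • z • x‖ ≤ 1 / 2 := by
        rw [norm_smul, norm_smul, norm_real, Real.norm_of_nonneg (by positivity), hz]
        have := pow_le_one₀ (n := n) hc0 hc1
        have := mul_le_one₀ this (norm_nonneg x) hx
        linarith
      have h3 := norm_sub_le (G^[n] (z • x)) (((c ^ n : ℝ) : ℂ) • z • x)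
      norm_num at *
      linarith
  have hks : k 0 = (s : ℂ) • L x x := Function.update_self _ _ _
  have hs0 : 0 ≤ s := le_trans (by positivity) hs
  rw [hks, norm_smul, norm_real, Real.norm_of_nonneg hs0] at hk0
  exact (mul_le_mul_of_nonneg_right hs (norm_nonneg _)).trans hk0

end Cartan

section Expansion

variable {A : Type*} [NormedRing A] [NormedAlgebra ℂ A]

/-- The Möbius transformation `a ↦ (a - t) (1 - t a)⁻¹` of an algebra. -/
noncomputable def mobius (t : ℝ) (a : A) : A :=
  (a - (t : ℂ) • 1) * Ring.inverse (1 - (t : ℂ) • a)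

theorem mobius_neg_sub (t : ℝ) (w : A) :
    mobius (-t) (w - (t : ℂ) • 1) =
      w * Ring.inverse ((1 - (t : ℂ) ^ 2) • (1 : A) + (t : ℂ) • w) := by
  have h1 : w - (t : ℂ) • (1 : A) - ((-t : ℝ) : ℂ) • (1 : A) = w := by
    push_cast
    module
  have h2 : (1 : A) - ((-t : ℝ) : ℂ) • (w - (t : ℂ) • 1) =
      (1 - (t : ℂ) ^ 2) • (1 : A) + (t : ℂ) • w := by
    push_cast
    module
  rw [mobius, h1, h2]

variable [CompleteSpace A]

theorem eventually_isUnit_smul_one_add {d : ℂ} (hd : d ≠ 0) (t : ℂ) :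
    ∀ᶠ w : A in 𝓝 0, IsUnit (d • (1 : A) + t • w) := by
  have hc : ContinuousAt (fun w : A => d • (1 : A) + t • w) 0 := by fun_prop
  refine hc.eventually_mem (Units.isOpen.mem_nhds ?_)
  simpa using (isUnit_one (M := A)).smul (Units.mk0 d hd)

theorem isBigO_mul_inverse_sub {d : ℂ} (hd : d ≠ 0) (t : ℂ) :
    (fun w : A => w * Ring.inverse (d • (1 : A) + t • w)
      - (d⁻¹ • w - (t * d⁻¹ ^ 2) • (w * w))) =O[𝓝 0] fun w => ‖w‖ ^ 3 := by
  have hc : ContinuousAt (fun w : A => Ring.inverse (d • (1 : A) + t • w)) 0 := by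
    have hu : IsUnit (d • (1 : A)) := (isUnit_one (M := A)).smul (Units.mk0 d hd)
    obtain ⟨u, hu⟩ := hu
    refine ContinuousAt.comp (g := Ring.inverse) (f := fun w : A => d • (1 : A) + t • w) ?_
      (by fun_prop)
    simpa [hu] using NormedRing.inverse_continuousAt u
  have h1 : (fun w : A => Ring.inverse (d • (1 : A) + t • w)) =O[𝓝 0] fun _ => (1 : ℝ) :=
    hc.tendsto.isBigO_one ℝ
  have hid : (fun w : A => w) =O[𝓝 0] fun w => ‖w‖ := (isBigO_refl _ _).norm_right
  have h2 := ((((hid.mul hid).mul hid).mul h1).const_smul_left (t ^ 2 * d⁻¹ ^ 2)).congr_right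
    (g₂ := fun w => ‖w‖ ^ 3) fun w => by ring
  refine h2.congr' ?_ EventuallyEq.rfl
  filter_upwards [eventually_isUnit_smul_one_add hd t] with w hw
  have hi := Ring.mul_inverse_cancel _ hw
  set c := Ring.inverse (d • (1 : A) + t • w)
  have h3 : d • c + t • (w * c) = 1 := by
    rw [← hi, add_mul, smul_mul_assoc, smul_mul_assoc, one_mul]
  have h4 : d • (w * c) + t • (w * w * c) = w := by
    have := congrArg (w * ·) h3
    simpa only [mul_add, mul_smul_comm, mul_one, ← mul_assoc] using this
  have h5 : d • (w * w * c) + t • (w * w * w * c) = w * w := by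
    have := congrArg (w * ·) h4
    simpa only [mul_add, mul_smul_comm, mul_one, ← mul_assoc] using this
  have h6 : d⁻¹ • w = w * c + (d⁻¹ * t) • (w * w * c) := by
    have := congrArg (d⁻¹ • ·) h4
    simpa only [smul_add, inv_smul_smul₀ hd, smul_smul] using this.symm
  have h7 : d⁻¹ • (w * w) = w * w * c + (d⁻¹ * t) • (w * w * w * c) := by
    have := congrArg (d⁻¹ • ·) h5
    simpa only [smul_add, inv_smul_smul₀ hd, smul_smul] using this.symm
  have h8 : (t * d⁻¹ ^ 2) • (w * w) = (t * d⁻¹) • d⁻¹ • (w * w) := by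
    rw [smul_smul]
    ring_nf
  rw [h6, h8, h7]
  simp only [Pi.smul_apply]
  module

theorem isBigO_mobius_sub (t : ℝ) :
    (fun b : A => mobius t b - (-((t : ℂ) • (1 : A)) + (1 - (t : ℂ) ^ 2) • (b + (t : ℂ) • (b * b))))
      =O[𝓝 0] fun b => ‖b‖ ^ 3 := by
  have h1 := (isBigO_mul_inverse_sub (A := A) one_ne_zero (-(t : ℂ))).const_smul_left
    (1 - (t : ℂ) ^ 2)
  refine h1.congr' ?_ EventuallyEq.rfl
  filter_upwards [eventually_isUnit_smul_one_add (A := A) one_ne_zero (-(t : ℂ))] with w hw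
  have hi := Ring.mul_inverse_cancel _ hw
  have he : (1 : ℂ) • (1 : A) + -(t : ℂ) • w = 1 - (t : ℂ) • w := by module
  simp only [Pi.smul_apply, mobius]
  rw [he] at hi ⊢
  set c := Ring.inverse (1 - (t : ℂ) • w)
  have h3 : c = 1 + (t : ℂ) • (w * c) := by
    rw [sub_mul, one_mul, smul_mul_assoc] at hi
    rw [← hi]; abel
  have h4 : (w - (t : ℂ) • 1) * c = w * c - (t : ℂ) • (1 + (t : ℂ) • (w * c)) := by
    rw [← h3, sub_mul, smul_mul_assoc, one_mul]
  rw [h4, inv_one]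
  module

theorem differentiableAt_mobius {t : ℝ} (ht : |t| < 1) {a : A} (ha : ‖a‖ ≤ 1) :
    DifferentiableAt ℂ (mobius t : A → A) a := by
  have hu : IsUnit (1 - (t : ℂ) • a) := by
    have := isUnit_smul_one_sub (z := 1) (w := t) ha (by simpa using ht)
    rwa [one_smul] at this
  obtain ⟨u, hu⟩ := hu
  have h1 : DifferentiableAt ℂ (fun a : A => Ring.inverse (1 - (t : ℂ) • a)) a := by
    refine DifferentiableAt.comp (g := Ring.inverse) (f := fun a : A => 1 - (t : ℂ) • a) a ?_
      (by fun_prop)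
    rw [← hu]
    exact differentiableAt_inverse u.isUnit
  exact DifferentiableAt.fun_mul (𝕜 := ℂ) (a := fun a : A => a - (t : ℂ) • 1) (by fun_prop) h1

end Expansion

section Jordan

variable {A B : Type*} [NormedRing A] [StarRing A] [CStarRing A] [NormedAlgebra ℂ A]
  [CompleteSpace A] [NormedRing B] [StarRing B] [CStarRing B] [NormedAlgebra ℂ B]
  [CompleteSpace B]

/-- The composite of Möbius transformations measuring the failure of `T` to respect squares. -/
noncomputable def mobiusConj (T : A ≃L[ℂ] B) (κ : ℝ) (x : A) : A :=
  mobius (-(κ / 2)) ((κ : ℂ) • T.symm (mobius (1 / 2) ((κ : ℂ) • T x)))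

/-- The quadratic part of `mobiusConj T κ`, where `c = 3κ² / (4 - κ²)`. -/
noncomputable def mobiusConjQuad (T : A ≃L[ℂ] B) (κ c : ℝ) : A →L[ℂ] A →L[ℂ] A :=
  ((κ * c / 2 : ℝ) : ℂ) • (ContinuousLinearMap.compL ℂ A B A (T.symm : B →L[ℂ] A) ∘L
    (ContinuousLinearMap.mul ℂ B).bilinearComp (T : A →L[ℂ] B) (T : A →L[ℂ] B))
    - ((κ / 2 * c ^ 2 : ℝ) : ℂ) • ContinuousLinearMap.mul ℂ A

omit [StarRing A] [CStarRing A] [CompleteSpace A] [StarRing B] [CStarRing B] [CompleteSpace B] in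
theorem mobiusConjQuad_apply (T : A ≃L[ℂ] B) (κ c : ℝ) (x y : A) :
    mobiusConjQuad T κ c x y =
      ((κ * c / 2 : ℝ) : ℂ) • T.symm (T x * T y) - ((κ / 2 * c ^ 2 : ℝ) : ℂ) • (x * y) := rfl

theorem norm_smul_apply_le {E F : Type*} [NormedAddCommGroup E] [NormedSpace ℂ E]
    [NormedAddCommGroup F] [NormedSpace ℂ F] (T : E →L[ℂ] F) {κ : ℝ} (hκ : 0 ≤ κ)
    (hT : κ * ‖T‖ ≤ 1) {x : E} (hx : ‖x‖ ≤ 1) : ‖(κ : ℂ) • T x‖ ≤ 1 := by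
  rw [norm_smul, norm_real, Real.norm_of_nonneg hκ]
  exact (mul_le_mul_of_nonneg_left (T.unit_le_opNorm x hx) hκ).trans hT

theorem norm_mobiusConj_le (T : A ≃L[ℂ] B) {κ : ℝ} (hκ0 : 0 < κ) (hκ1 : κ ≤ 1)
    (hT : κ * ‖(T : A →L[ℂ] B)‖ ≤ 1) (hS : κ * ‖(T.symm : B →L[ℂ] A)‖ ≤ 1) {x : A}
    (hx : ‖x‖ ≤ 1) : ‖mobiusConj T κ x‖ ≤ 1 := by
  refine norm_mobius_le (norm_smul_apply_le (T.symm : B →L[ℂ] A) hκ0.le hS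
    (norm_mobius_le (norm_smul_apply_le (T : A →L[ℂ] B) hκ0.le hT hx) ?_)) ?_
  · rw [abs_lt]; norm_num
  · rw [abs_lt]; constructor <;> linarith

omit [StarRing A] [CStarRing A] in
theorem differentiableAt_mobiusConj (T : A ≃L[ℂ] B) {κ : ℝ} (hκ0 : 0 < κ) (hκ1 : κ ≤ 1)
    (hT : κ * ‖(T : A →L[ℂ] B)‖ ≤ 1) (hS : κ * ‖(T.symm : B →L[ℂ] A)‖ ≤ 1) {x : A}
    (hx : ‖x‖ ≤ 1) : DifferentiableAt ℂ (mobiusConj T κ) x := by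
  have ht : |(1 / 2 : ℝ)| < 1 := by rw [abs_lt]; norm_num
  have h1 := norm_smul_apply_le (T : A →L[ℂ] B) hκ0.le hT hx
  have h2 : DifferentiableAt ℂ (fun x => mobius (1 / 2) ((κ : ℂ) • T x)) x :=
    DifferentiableAt.comp (f := fun x => (κ : ℂ) • T x) x (differentiableAt_mobius ht h1)
      (T.differentiableAt.fun_const_smul _)
  have h3 : DifferentiableAt ℂ (fun x => (κ : ℂ) • T.symm (mobius (1 / 2) ((κ : ℂ) • T x))) x :=
    (T.symm.differentiableAt.comp x h2).fun_const_smul (κ : ℂ)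
  refine DifferentiableAt.comp
    (f := fun x => (κ : ℂ) • T.symm (mobius (1 / 2) ((κ : ℂ) • T x))) x
    (differentiableAt_mobius ?_ (norm_smul_apply_le (T.symm : B →L[ℂ] A) hκ0.le hS
    (norm_mobius_le h1 ht))) h3
  rw [abs_lt]; constructor <;> linarith

omit [StarRing A] [CStarRing A] [StarRing B] [CStarRing B] in
theorem isBigO_mobiusConj_sub (T : A ≃L[ℂ] B) (hT1 : T 1 = 1) {κ c : ℝ} (hκ0 : 0 < κ)
    (hκ1 : κ ≤ 1) (hc : c * (4 - κ ^ 2) = 3 * κ ^ 2) :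
    (fun x => mobiusConj T κ x - ((c : ℂ) • x + mobiusConjQuad T κ c x x)) =O[𝓝 0]
      fun x => ‖x‖ ^ 3 := by
  have hS1 : T.symm 1 = 1 := by rw [← hT1, T.symm_apply_apply]
  set α : ℂ := 3 / 4 * (κ : ℂ) ^ 2 with hα
  set w : A → A := fun x => (κ : ℂ) • T.symm (mobius (1 / 2) ((κ : ℂ) • T x))
    + ((κ / 2 : ℝ) : ℂ) • 1 with hw
  have hd : (1 - (((κ / 2 : ℝ) : ℂ)) ^ 2 : ℂ) ≠ 0 := by
    have : (1 - (κ / 2) ^ 2 : ℝ) ≠ 0 := by nlinarith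
    exact_mod_cast this
  set d : ℂ := 1 - ((κ / 2 : ℝ) : ℂ) ^ 2 with hddef
  have hcd : (c : ℂ) = d⁻¹ * α := by
    rw [eq_inv_mul_iff_mul_eq₀ hd, hddef, hα]
    have : (c : ℂ) * (4 - κ ^ 2) = 3 * κ ^ 2 := by exact_mod_cast hc
    push_cast
    linear_combination this / 4
  have hid : (fun x : A => x) =O[𝓝 0] fun x => ‖x‖ := (isBigO_refl _ _).norm_right
  have hTx : (fun x : A => T x) =O[𝓝 0] fun x => ‖x‖ :=
    ((T : A →L[ℂ] B).isBigO_id _).norm_right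
  have hb : (fun x : A => (κ : ℂ) • T x) =O[𝓝 0] fun x => ‖x‖ := hTx.const_smul_left (κ : ℂ)
  have hb0 : Tendsto (fun x : A => (κ : ℂ) • T x) (𝓝 0) (𝓝 0) :=
    hb.trans_tendsto (by simpa using tendsto_norm_zero (E := A))
  have h1 := (((T.symm : B →L[ℂ] A).isBigO_comp _ _).trans
    (((isBigO_mobius_sub (A := B) (1 / 2)).comp_tendsto hb0).trans
      (hb.norm_left.pow 3))).const_smul_left (κ : ℂ)
  have hwexp : (fun x => w x - (α • x + ((3 / 8 * κ ^ 3 : ℝ) : ℂ) • T.symm (T x * T x)))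
      =O[𝓝 0] fun x => ‖x‖ ^ 3 := by
    refine h1.congr_left fun x => ?_
    simp only [Pi.smul_apply, Function.comp_apply, hw, ContinuousLinearEquiv.coe_coe, map_sub,
      map_add, map_neg, map_smul, hS1, T.symm_apply_apply, smul_mul_smul_comm, hα]
    push_cast
    module
  have hq : (fun x => T.symm (T x * T x)) =O[𝓝 0] fun x => ‖x‖ ^ 2 :=
    (((T.symm : B →L[ℂ] A).isBigO_comp _ _).trans (hTx.mul hTx)).congr_right fun x => by ring
  have hw2 : (fun x => w x - α • x) =O[𝓝 0] fun x => ‖x‖ ^ 2 :=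
    ((hwexp.trans (isBigO_norm_pow_of_le (show 2 ≤ 3 by norm_num))).add
      (hq.const_smul_left ((3 / 8 * κ ^ 3 : ℝ) : ℂ))).congr_left fun x => by
        simp only [Pi.smul_apply]; abel
  have hw1 : w =O[𝓝 0] fun x => ‖x‖ := by
    have h1 : (fun x : A => ‖x‖ ^ 2) =O[𝓝 0] fun x : A => ‖x‖ := by
      simpa using isBigO_norm_pow_of_le (E := A) (show 1 ≤ 2 by norm_num)
    exact ((hw2.trans h1).add (hid.const_smul_left α)).congr_left fun x => by simp
  have hw0 : Tendsto w (𝓝 0) (𝓝 0) :=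
    hw1.trans_tendsto (by simpa using tendsto_norm_zero (E := A))
  have h2 := ((isBigO_mul_inverse_sub (A := A) hd ((κ / 2 : ℝ) : ℂ)).comp_tendsto hw0).trans
    (hw1.norm_left.pow 3)
  have h3 : (fun x => (w x - α • x) * w x) =O[𝓝 0] fun x => ‖x‖ ^ 3 :=
    (hw2.mul hw1).congr_right fun x => by ring
  have h4 : (fun x => (α • x) * (w x - α • x)) =O[𝓝 0] fun x => ‖x‖ ^ 3 :=
    ((hid.const_smul_left α).mul hw2).congr_right fun x => by ring
  refine ((h2.add (hwexp.const_smul_left d⁻¹)).sub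
    ((h3.add h4).const_smul_left (((κ / 2 : ℝ) : ℂ) * d⁻¹ ^ 2))).congr_left fun x => ?_
  have hG : mobiusConj T κ x = w x * Ring.inverse (d • (1 : A) + ((κ / 2 : ℝ) : ℂ) • w x) := by
    rw [hddef, ← mobius_neg_sub, mobiusConj]
    simp only [hw, add_sub_cancel_right]
  simp only [Function.comp_apply, Pi.smul_apply]
  rw [← hG, mobiusConjQuad_apply]
  simp only [sub_mul, mul_sub, smul_mul_assoc, mul_smul_comm]
  push_cast
  rw [hcd]
  simp only [hα]
  match_scalars <;> ring

theorem norm_symm_sq_sub_le (T : A ≃L[ℂ] B) (hT1 : T 1 = 1) {κ c : ℝ} (hκ0 : 0 < κ)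
    (hκ1 : κ ≤ 1) (hT : κ * ‖(T : A →L[ℂ] B)‖ ≤ 1) (hS : κ * ‖(T.symm : B →L[ℂ] A)‖ ≤ 1)
    (hc0 : 0 ≤ c) (hc1 : c ≤ 1)
    (hc : c * (4 - κ ^ 2) = 3 * κ ^ 2) (n : ℕ) {x : A} (hx : ‖x‖ ≤ 1) :
    n * c ^ (2 * n) * (κ * c / 2 * ‖T.symm (T x * T x) - (c : ℂ) • (x * x)‖) ≤ 6 := by
  have h := quadratic_part_le (fun y hy => norm_mobiusConj_le T hκ0 hκ1 hT hS hy)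
    (fun y hy => differentiableAt_mobiusConj T hκ0 hκ1 hT hS hy) hc0 hc1
    (isBigO_mobiusConj_sub T hT1 hκ0 hκ1 hc) n hx
  have hq : mobiusConjQuad T κ c x x =
      ((κ * c / 2 : ℝ) : ℂ) • (T.symm (T x * T x) - (c : ℂ) • (x * x)) := by
    rw [mobiusConjQuad_apply]
    push_cast
    module
  rwa [hq, norm_smul, norm_real, Real.norm_of_nonneg (by positivity)] at h

/-- A linear map respecting squares up to `ε` on the unit ball is an approximate Jordan
homomorphism. -/
theorem norm_jordan_defect_le {A B : Type*} [NormedRing A] [NormedAlgebra ℂ A] [NormedRing B]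
    [NormedAlgebra ℂ B] (T : A ≃L[ℂ] B) {ε : ℝ}
    (h : ∀ x : A, ‖x‖ ≤ 1 → ‖T x * T x - T (x * x)‖ ≤ ε) {a a' : A} (ha : ‖a‖ ≤ 1)
    (ha' : ‖a'‖ ≤ 1) : ‖T (a * a') + T (a' * a) - T a * T a' - T a' * T a‖ ≤ 6 * ε := by
  set y := (2⁻¹ : ℂ) • (a + a') with hy
  have hy1 : ‖y‖ ≤ 1 := by
    rw [hy, norm_smul]
    have := norm_add_le a a'
    norm_num
    linarith
  have haa : a + a' = (2 : ℂ) • y := by rw [hy, smul_smul]; norm_num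
  have hid : T (a * a') + T (a' * a) - T a * T a' - T a' * T a =
      (T a * T a - T (a * a)) + (T a' * T a' - T (a' * a'))
        - (4 : ℂ) • (T y * T y - T (y * y)) := by
    have h1 : (4 : ℂ) • (T y * T y - T (y * y)) =
        T (a + a') * T (a + a') - T ((a + a') * (a + a')) := by
      rw [haa]
      simp only [map_smul, smul_mul_smul_comm]
      module
    rw [h1]
    simp only [map_add, add_mul, mul_add]
    abel
  rw [hid]
  refine (norm_sub_le _ _).trans ?_
  rw [norm_smul]
  have h1 := norm_add_le (T a * T a - T (a * a)) (T a' * T a' - T (a' * a'))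
  have h2 := h a ha
  have h3 := h a' ha'
  have h4 := h y hy1
  norm_num
  linarith

theorem norm_sq_sub_le (T : A ≃L[ℂ] B) (hT1 : T 1 = 1) {κ c : ℝ} (hκ : 1 / 2 ≤ κ) (hκ1 : κ ≤ 1)
    (hT : κ * ‖(T : A →L[ℂ] B)‖ ≤ 1) (hS : κ * ‖(T.symm : B →L[ℂ] A)‖ ≤ 1) (hc0 : 1 / 2 ≤ c)
    (hc1 : c ≤ 1) (hc : c * (4 - κ ^ 2) = 3 * κ ^ 2) {n : ℕ} (hn : 0 < n)
    (hcn : 1 / 2 ≤ c ^ (2 * n)) {x : A} (hx : ‖x‖ ≤ 1) :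
    ‖T x * T x - T (x * x)‖ ≤ 2 * (96 / n + (1 - c)) := by
  have hTn : ‖(T : A →L[ℂ] B)‖ ≤ 2 := by
    nlinarith [norm_nonneg (T : A →L[ℂ] B)]
  have h := norm_symm_sq_sub_le T hT1 (by linarith) hκ1 hT hS (by linarith) hc1 hc n hx
  set q := T.symm (T x * T x) - (c : ℂ) • (x * x)
  have hn' : (0 : ℝ) < n := by exact_mod_cast hn
  have h1 : ‖q‖ ≤ 96 / n := by
    rw [le_div_iff₀ hn']
    have h2 : (1 / 8 : ℝ) ≤ κ * c / 2 := by nlinarith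
    have h3 : (n : ℝ) * (1 / 2) * (1 / 8 * ‖q‖) ≤ 6 := by
      refine le_trans ?_ h
      gcongr
    linarith
  have h2 : T x * T x - T (x * x) = T (q - ((1 - c : ℝ) : ℂ) • (x * x)) := by
    simp only [q, map_sub, map_smul, T.apply_symm_apply]
    push_cast
    module
  have h3 : ‖((1 - c : ℝ) : ℂ) • (x * x)‖ ≤ 1 - c := by
    rw [norm_smul, norm_real, Real.norm_of_nonneg (by linarith)]
    exact mul_le_of_le_one_right (by linarith)
      ((norm_mul_le _ _).trans (mul_le_one₀ hx (norm_nonneg _) hx))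
  rw [h2]
  refine ((T : A →L[ℂ] B).le_opNorm _).trans ?_
  exact mul_le_mul hTn ((norm_sub_le _ _).trans (add_le_add h1 h3)) (norm_nonneg _) two_pos.le

end Jordan

/-- For every `η > 0` there is `ρ > 0` such that every unital bounded linear bijection `T`
between unital C*-algebras with `‖T‖ ≤ 1 + ρ` and `‖T⁻¹‖ ≤ 1 + ρ` has Jordan defect
`T(aa') + T(a'a) - T(a)T(a') - T(a')T(a)` of norm at most `η` on the unit ball. -/
theorem exists_rho_jordan_defect_small.{u} :
    ∀ η : ℝ, 0 < η → ∃ ρ : ℝ, 0 < ρ ∧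
      ∀ (A B : Type u) [NormedRing A] [StarRing A] [CStarRing A] [NormedAlgebra ℂ A]
        [CompleteSpace A] [NormedRing B] [StarRing B] [CStarRing B] [NormedAlgebra ℂ B]
        [CompleteSpace B] (T : A ≃L[ℂ] B),
        T 1 = 1 → ‖(T : A →L[ℂ] B)‖ ≤ 1 + ρ → ‖(T.symm : B →L[ℂ] A)‖ ≤ 1 + ρ →
        ∀ a a' : A, ‖a‖ ≤ 1 → ‖a'‖ ≤ 1 →
          ‖T (a * a') + T (a' * a) - T a * T a' - T a' * T a‖ ≤ η := by
  intro η hη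
  obtain ⟨n, hn⟩ := exists_nat_gt (96 * 24 / η)
  have hn0 : (0 : ℝ) < n := lt_trans (by positivity) hn
  have hcont : ContinuousAt (fun ρ : ℝ => 3 * ((1 + ρ)⁻¹) ^ 2 / (4 - ((1 + ρ)⁻¹) ^ 2)) 0 := by
    have h1 : ContinuousAt (fun ρ : ℝ => (1 + ρ)⁻¹) 0 :=
      ContinuousAt.inv₀ (by fun_prop) (by norm_num)
    exact ContinuousAt.div (by fun_prop) (by fun_prop) (by norm_num)
  have hev : ∀ᶠ ρ : ℝ in 𝓝[>] 0, 0 < ρ ∧ ρ ≤ 1 ∧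
      1 / 2 < 3 * ((1 + ρ)⁻¹) ^ 2 / (4 - ((1 + ρ)⁻¹) ^ 2) ∧
      1 - η / 24 < 3 * ((1 + ρ)⁻¹) ^ 2 / (4 - ((1 + ρ)⁻¹) ^ 2) ∧
      1 / 2 < (3 * ((1 + ρ)⁻¹) ^ 2 / (4 - ((1 + ρ)⁻¹) ^ 2)) ^ (2 * n) := by
    have h0 : Set.Iic (1 : ℝ) ∈ 𝓝[>] 0 := mem_nhdsWithin_of_mem_nhds (Iic_mem_nhds one_pos)
    have h1 := hcont.tendsto.mono_left (nhdsWithin_le_nhds (s := Set.Ioi 0))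
    norm_num at h1
    have h2 := h1.pow (2 * n)
    rw [one_pow] at h2
    filter_upwards [self_mem_nhdsWithin, h0, h1.eventually_const_lt (by norm_num : (1 / 2 : ℝ) < 1),
      h1.eventually_const_lt (by linarith : 1 - η / 24 < 1),
      h2.eventually_const_lt (by norm_num : (1 / 2 : ℝ) < 1)] with ρ a b c d e
    norm_num at *
    exact ⟨a, b, c, d, e⟩
  obtain ⟨ρ, hρ, hρ1, hc, hcη, hcn⟩ := hev.exists
  refine ⟨ρ, hρ, fun A B _ _ _ _ _ _ _ _ _ _ T hT1 hT hS a a' ha ha' => ?_⟩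
  set κ := (1 + ρ)⁻¹ with hκ
  have hκ0 : 0 < κ := by positivity
  have hκ1 : κ ≤ 1 := inv_le_one_of_one_le₀ (by linarith)
  have hκ2 : 1 / 2 ≤ κ := by
    rw [hκ, one_div]
    exact inv_anti₀ (by linarith) (by linarith)
  have hκρ : κ * (1 + ρ) = 1 := inv_mul_cancel₀ (by linarith)
  have hd : 0 < 4 - κ ^ 2 := by nlinarith
  have hc1 : 3 * κ ^ 2 / (4 - κ ^ 2) ≤ 1 := by
    rw [div_le_one hd]
    nlinarith
  have hnη : 96 / (n : ℝ) ≤ η / 24 := by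
    rw [div_lt_iff₀ hη] at hn
    rw [div_le_iff₀ hn0]
    linarith
  have h := norm_jordan_defect_le T (fun x hx => norm_sq_sub_le T hT1 hκ2 hκ1
    ((mul_le_mul_of_nonneg_left hT hκ0.le).trans hκρ.le)
    ((mul_le_mul_of_nonneg_left hS hκ0.le).trans hκρ.le) hc.le hc1
    (div_mul_cancel₀ _ hd.ne') (Nat.cast_pos.1 hn0) hcn.le hx) ha ha'
  linarith
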